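/- For s ≥ 3 an integer, 0 ≤ |β| ≤ s - 1, and u, v ∈ C₀^∞(ℝ³): ‖[D^β, u] v‖_{L²} ≲ (‖Du‖_{R^{s-2}} + ‖Du‖_{L²}) ‖v‖_{R^{s-1}}, where [D^β, u]v = D^β(uv) - u D^β v. -/

import Mathlib

open MeasureTheory
open scoped ENNReal NNReal

/-- The partial derivative `∂_i f` on `ℝ³`. -/
noncomputable def pd (i : Fin 3) (f : EuclideanSpace ℝ (Fin 3) → ℝ) :
    EuclideanSpace ℝ (Fin 3) → ℝ :=
  fun x => fderiv ℝ f x (EuclideanSpace.single i 1)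

/-- The multi-index derivative `D^β = ∂₁^{β₁} ∂₂^{β₂} ∂₃^{β₃}` on `ℝ³`. -/
noncomputable def Dmulti (β : Fin 3 → ℕ) (f : EuclideanSpace ℝ (Fin 3) → ℝ) :
    EuclideanSpace ℝ (Fin 3) → ℝ :=
  (pd 0)^[β 0] ((pd 1)^[β 1] ((pd 2)^[β 2] f))

/-- The `R^k` norm on `ℝ³`: `‖f‖_{R^k} = ‖Df‖_{H^{k-1}} + ‖f‖_{L^6}`. -/
noncomputable def RNorm (k : ℕ) {F : Type*} [NormedAddCommGroup F] [NormedSpace ℝ F]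
    (f : EuclideanSpace ℝ (Fin 3) → F) : ℝ≥0∞ :=
  (∑ j ∈ Finset.Icc 1 k, eLpNorm (fun x => ‖iteratedFDeriv ℝ j f x‖) 2 volume)
    + eLpNorm (fun x => ‖f x‖) 6 volume

open scoped SchwartzMap FourierTransform LineDeriv

local notation "ℝ³" => EuclideanSpace ℝ (Fin 3)

theorem eLpNorm_three_le_of_two_of_six {α F : Type*} [MeasurableSpace α] {μ : Measure α}
    [NormedAddCommGroup F] {f : α → F} (hf : AEStronglyMeasurable f μ) {A : ℝ≥0∞}
    (h2 : eLpNorm f 2 μ ≤ A) (h6 : eLpNorm f 6 μ ≤ A) : eLpNorm f 3 μ ≤ A := by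
  have hH : ENNReal.HolderTriple 4 12 3 := ⟨by
    rw [← ENNReal.toReal_eq_toReal_iff' (by simp) (by simp), ENNReal.toReal_add (by simp) (by simp)]
    norm_num⟩
  have key : ∀ p q : ℝ≥0∞, q * ENNReal.ofReal (1 / 2) = p → eLpNorm f p μ ≤ A →
      eLpNorm (fun x => ‖f x‖ ^ (1 / 2 : ℝ)) q μ ≤ A ^ (1 / 2 : ℝ) := by
    intro p q hpq h
    rw [eLpNorm_norm_rpow f (by norm_num), hpq]
    gcongr
  have half : ∀ a b : ℝ≥0∞, a ≠ ⊤ → b ≠ ⊤ → a.toReal * (1 / 2) = b.toReal →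
      a * ENNReal.ofReal (1 / 2) = b := by
    intro a b ha hb h
    rw [← ENNReal.toReal_eq_toReal_iff' (by finiteness) hb, ENNReal.toReal_mul,
      ENNReal.toReal_ofReal (by norm_num), h]
  have hm : AEStronglyMeasurable (fun x => ‖f x‖ ^ (1 / 2 : ℝ)) μ :=
    (hf.norm.aemeasurable.pow_const _).aestronglyMeasurable
  have := eLpNorm_smul_le_mul_eLpNorm (p := 4) (q := 12) (r := 3) hm hm
  calc eLpNorm f 3 μ
      = eLpNorm ((fun x => ‖f x‖ ^ (1 / 2 : ℝ)) • (fun x => ‖f x‖ ^ (1 / 2 : ℝ))) 3 μ := by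
        refine eLpNorm_congr_norm_ae (.of_forall fun x => ?_)
        simp only [Pi.smul_apply', smul_eq_mul, ← Real.rpow_add_of_nonneg (norm_nonneg (f x))
          (by norm_num : (0 : ℝ) ≤ 1 / 2) (by norm_num : (0 : ℝ) ≤ 1 / 2)]
        norm_num
    _ ≤ A ^ (1 / 2 : ℝ) * A ^ (1 / 2 : ℝ) :=
        this.trans (mul_le_mul' (key 2 4 (half _ _ (by simp) (by simp) (by norm_num)) h2)
          (key 6 12 (half _ _ (by simp) (by simp) (by norm_num)) h6))
    _ = A := by
        rw [← ENNReal.rpow_add_of_nonneg _ _ (by norm_num) (by norm_num)]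
        norm_num

theorem finiteDimensional_continuousMultilinearMap (n : ℕ) :
    FiniteDimensional ℝ (ContinuousMultilinearMap ℝ (fun _ : Fin n => ℝ³) ℝ) :=
  FiniteDimensional.of_injective
    (ContinuousMultilinearMap.toMultilinearMapLinear (R' := ℝ) (A := ℝ)
      (M₁ := fun _ : Fin n => ℝ³) (M₂ := ℝ))
    ContinuousMultilinearMap.toMultilinearMap_injective

/-- The Sobolev inequality `‖Dⁿf‖_{L⁶} ≲ ‖Dⁿ⁺¹f‖_{L²}` on `ℝ³`. -/
theorem exists_eLpNorm_six_iteratedFDeriv_le (n : ℕ) :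
    ∃ K : ℝ≥0, ∀ f : ℝ³ → ℝ, ContDiff ℝ (⊤ : ℕ∞) f → HasCompactSupport f →
      eLpNorm (fun x => ‖iteratedFDeriv ℝ n f x‖) 6 volume
        ≤ K * eLpNorm (fun x => ‖iteratedFDeriv ℝ (n + 1) f x‖) 2 volume := by
  have := finiteDimensional_continuousMultilinearMap n
  refine ⟨SNormLESNormFDerivOfEqConst (ContinuousMultilinearMap ℝ (fun _ : Fin n => ℝ³) ℝ)
    (volume : Measure ℝ³) 2, fun f hf hc => ?_⟩
  have h := eLpNorm_le_eLpNorm_fderiv_of_eq (volume : Measure ℝ³) (u := iteratedFDeriv ℝ n f)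
    (p := 2) (p' := 6) (hf.iteratedFDeriv_right (by exact_mod_cast le_top)) (hc.iteratedFDeriv n)
    (by norm_num) (by simp) (by simp; norm_num)
  rw [eLpNorm_norm]
  refine h.trans_eq (congrArg _ (eLpNorm_congr_norm_ae (.of_forall fun x => ?_)))
  rw [norm_norm, norm_fderiv_iteratedFDeriv]

theorem memLp_two_weight :
    MemLp (fun ξ : ℝ³ => ‖ξ‖⁻¹ * (1 + ‖ξ‖)⁻¹) 2 volume := by
  have hm : AEStronglyMeasurable (fun ξ : ℝ³ => ‖ξ‖⁻¹ * (1 + ‖ξ‖)⁻¹) volume :=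
    (by fun_prop : Measurable (fun ξ : ℝ³ => ‖ξ‖⁻¹ * (1 + ‖ξ‖)⁻¹)).aestronglyMeasurable
  rw [memLp_two_iff_integrable_sq hm]
  rw [integrable_fun_norm_addHaar (volume : Measure ℝ³) (f := fun r : ℝ => (r⁻¹ * (1 + r)⁻¹) ^ 2)]
  refine Integrable.mono' (integrable_inv_one_add_sq.integrableOn (s := Set.Ioi 0))
    (by fun_prop) ?_
  filter_upwards [ae_restrict_mem measurableSet_Ioi] with r hr
  have hr : 0 < r := hr
  simp only [finrank_euclideanSpace, Fintype.card_fin, smul_eq_mul]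
  rw [Real.norm_of_nonneg (by positivity)]
  have : r ^ (3 - 1) * (r⁻¹ * (1 + r)⁻¹) ^ 2 = ((1 + r) ^ 2)⁻¹ := by field_simp
  rw [this]
  gcongr
  nlinarith

theorem eLpNorm_two_fourier (f : 𝓢(ℝ³, ℂ)) :
    eLpNorm (𝓕 f : 𝓢(ℝ³, ℂ)) 2 volume = eLpNorm f 2 volume := by
  refine (ENNReal.toReal_eq_toReal_iff' ((𝓕 f : 𝓢(ℝ³, ℂ)).eLpNorm_lt_top 2 volume).ne
    (f.eLpNorm_lt_top 2 volume).ne).1 ?_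
  exact (SchwartzMap.norm_toLp (f := (𝓕 f : 𝓢(ℝ³, ℂ))) (p := 2) (μ := volume)).symm.trans
    ((SchwartzMap.norm_fourier_toL2_eq f).trans (SchwartzMap.norm_toLp (f := f)))

theorem norm_fourier_lineDeriv (f : 𝓢(ℝ³, ℂ)) (m ξ : ℝ³) :
    ‖𝓕 (∂_{m} f) ξ‖ = 2 * Real.pi * |inner ℝ ξ m| * ‖𝓕 f ξ‖ := by
  have : (inner ℝ · m).HasTemperateGrowth := ((innerSL ℝ).flip m).hasTemperateGrowth
  rw [SchwartzMap.fourier_lineDerivOp_eq, smul_apply,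
    SchwartzMap.smulLeftCLM_apply_apply this]
  simp [abs_of_pos Real.pi_pos, mul_assoc]

theorem enorm_le_eLpNorm_one_fourier (f : 𝓢(ℝ³, ℂ)) (x : ℝ³) :
    ‖f x‖ₑ ≤ eLpNorm (𝓕 f : 𝓢(ℝ³, ℂ)) 1 volume := by
  have h := SchwartzMap.norm_fourier_apply_le_toLp_one (𝓕 f : 𝓢(ℝ³, ℂ)) (-x)
  have hx : 𝓕 (𝓕 f : 𝓢(ℝ³, ℂ)) (-x) = f x := by
    conv_rhs => rw [← FourierTransform.fourierInv_fourier_eq (F := 𝓢(ℝ³, ℂ)) f, SchwartzMap.fourierInv_apply_eq]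
    rfl
  rw [hx, SchwartzMap.norm_toLp] at h
  rw [← ofReal_norm]
  exact (ENNReal.ofReal_le_ofReal h).trans ENNReal.ofReal_toReal_le

/-- Off the origin, the Fourier transform of `f` is controlled by those of the derivatives of order
one and two, with a square-integrable weight. -/
theorem norm_fourier_le_weight_mul (f : 𝓢(ℝ³, ℂ)) {ξ : ℝ³} (hξ : ξ ≠ 0) :
    ‖𝓕 f ξ‖ ≤ (‖ξ‖⁻¹ * (1 + ‖ξ‖)⁻¹) *
      ∑ i : Fin 3, (‖𝓕 (∂_{EuclideanSpace.single i (1 : ℝ)} f) ξ‖ +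
        ‖𝓕 (∂_{EuclideanSpace.single i (1 : ℝ)} (∂_{EuclideanSpace.single i (1 : ℝ)} f)) ξ‖) := by
  have hpos : 0 < ‖ξ‖ := norm_pos_iff.2 hξ
  have hsq := EuclideanSpace.real_norm_sq_eq ξ
  rw [Fin.sum_univ_three] at hsq
  have h1 : ‖ξ‖ ≤ |ξ 0| + |ξ 1| + |ξ 2| := by
    refine abs_le_of_sq_le_sq' ?_ (by positivity) |>.2
    rw [hsq, ← sq_abs (ξ 0), ← sq_abs (ξ 1), ← sq_abs (ξ 2)]
    have h0 := abs_nonneg (ξ 0)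
    have h1 := abs_nonneg (ξ 1)
    have h2 := abs_nonneg (ξ 2)
    nlinarith [mul_nonneg h0 h1, mul_nonneg h1 h2, mul_nonneg h0 h2]
  have hpi : 1 ≤ 2 * Real.pi := by linarith [Real.pi_gt_three]
  have hsum : ‖ξ‖ * (1 + ‖ξ‖) * ‖𝓕 f ξ‖ ≤
      ∑ i : Fin 3, (‖𝓕 (∂_{EuclideanSpace.single i (1 : ℝ)} f) ξ‖ +
        ‖𝓕 (∂_{EuclideanSpace.single i (1 : ℝ)} (∂_{EuclideanSpace.single i (1 : ℝ)} f)) ξ‖) := by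
    have hterm : ∀ i : Fin 3, (|ξ i| + ξ i ^ 2) * ‖𝓕 f ξ‖ ≤
        ‖𝓕 (∂_{EuclideanSpace.single i (1 : ℝ)} f) ξ‖ +
        ‖𝓕 (∂_{EuclideanSpace.single i (1 : ℝ)} (∂_{EuclideanSpace.single i (1 : ℝ)} f)) ξ‖ := by
      intro i
      have hin : inner ℝ ξ (EuclideanSpace.single i (1 : ℝ)) = ξ i := by
        simp [EuclideanSpace.inner_single_right]
      rw [norm_fourier_lineDeriv, norm_fourier_lineDeriv, norm_fourier_lineDeriv, hin, add_mul,
        ← sq_abs (ξ i)]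
      have ha : |ξ i| ≤ 2 * Real.pi * |ξ i| := le_mul_of_one_le_left (abs_nonneg _) hpi
      have hb : |ξ i| ^ 2 ≤ (2 * Real.pi * |ξ i|) * (2 * Real.pi * |ξ i|) := by
        rw [sq]; gcongr
      rw [← mul_assoc (2 * Real.pi * |ξ i|) (2 * Real.pi * |ξ i|)]
      gcongr
    refine le_trans ?_ (Finset.sum_le_sum fun i _ => hterm i)
    rw [← Finset.sum_mul, Fin.sum_univ_three]
    gcongr
    nlinarith
  rw [← mul_inv, inv_mul_eq_div, le_div_iff₀ (by positivity)]
  linarith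

/-- The Sobolev embedding `‖v‖_{L^∞} ≲ ‖Dv‖_{L²} + ‖D²v‖_{L²}` on `ℝ³`. -/
theorem exists_enorm_le_eLpNorm_two_iteratedFDeriv :
    ∃ K : ℝ≥0, ∀ v : ℝ³ → ℝ, ContDiff ℝ (⊤ : ℕ∞) v → HasCompactSupport v → ∀ x,
      ‖v x‖ₑ ≤ K * (eLpNorm (fun x => ‖iteratedFDeriv ℝ 1 v x‖) 2 volume
        + eLpNorm (fun x => ‖iteratedFDeriv ℝ 2 v x‖) 2 volume) := by
  set w : ℝ³ → ℝ := fun ξ => ‖ξ‖⁻¹ * (1 + ‖ξ‖)⁻¹ with hw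
  refine ⟨(eLpNorm w 2 volume).toNNReal * 3, fun v hv hc x => ?_⟩
  have hf : ContDiff ℝ (⊤ : ℕ∞) (fun y => (v y : ℂ)) := Complex.ofRealCLM.contDiff.comp hv
  let f : 𝓢(ℝ³, ℂ) := (hc.comp_left Complex.ofReal_zero).toSchwartzMap hf
  have hnorm : ∀ (n : ℕ) (y : ℝ³), ‖iteratedFDeriv ℝ n f y‖ = ‖iteratedFDeriv ℝ n v y‖ :=
    fun n y => Complex.ofRealLI.norm_iteratedFDeriv_comp_left (hv.contDiffAt (x := y))
      (by exact_mod_cast le_top)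
  have hderiv : ∀ (n : ℕ) (m : Fin n → ℝ³), (∀ j, ‖m j‖ ≤ 1) →
      eLpNorm (𝓕 (∂^{m} f) : 𝓢(ℝ³, ℂ)) 2 volume
        ≤ eLpNorm (fun x => ‖iteratedFDeriv ℝ n v x‖) 2 volume := by
    intro n m hm
    rw [eLpNorm_two_fourier]
    refine eLpNorm_mono fun y => ?_
    rw [SchwartzMap.iteratedLineDerivOp_eq_iteratedFDeriv, norm_norm, ← hnorm]
    exact (ContinuousMultilinearMap.le_opNorm _ _).trans
      (mul_le_of_le_one_right (norm_nonneg _)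
        (Finset.prod_le_one (fun _ _ => norm_nonneg _) fun j _ => hm j))
  set G : Fin 3 → ℝ³ → ℝ := fun i ξ => ‖𝓕 (∂_{EuclideanSpace.single i (1 : ℝ)} f) ξ‖ +
    ‖𝓕 (∂_{EuclideanSpace.single i (1 : ℝ)} (∂_{EuclideanSpace.single i (1 : ℝ)} f)) ξ‖ with hG
  have hGm : ∀ i, AEStronglyMeasurable (G i) volume := fun i =>
    ((SchwartzMap.continuous _).norm.add (SchwartzMap.continuous _).norm).aestronglyMeasurable
  have hGle : ∀ i, eLpNorm (G i) 2 volume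
      ≤ eLpNorm (fun x => ‖iteratedFDeriv ℝ 1 v x‖) 2 volume
        + eLpNorm (fun x => ‖iteratedFDeriv ℝ 2 v x‖) 2 volume := by
    intro i
    refine (eLpNorm_add_le (SchwartzMap.continuous _).norm.aestronglyMeasurable
      (SchwartzMap.continuous _).norm.aestronglyMeasurable (by norm_num)).trans ?_
    rw [eLpNorm_norm, eLpNorm_norm]
    have h1 := hderiv 1 (fun _ => EuclideanSpace.single i (1 : ℝ)) (by simp)
    have h2 := hderiv 2 (fun _ => EuclideanSpace.single i (1 : ℝ)) (by simp)
    exact add_le_add h1 h2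
  have hfour : eLpNorm (𝓕 f : 𝓢(ℝ³, ℂ)) 1 volume
      ≤ eLpNorm w 2 volume * eLpNorm (∑ i, G i) 2 volume := by
    refine le_trans ?_ (eLpNorm_smul_le_mul_eLpNorm (r := 1)
      (Finset.aestronglyMeasurable_sum _ fun i _ => hGm i) memLp_two_weight.1)
    refine eLpNorm_mono_ae ?_
    filter_upwards [Measure.ae_ne volume (0 : ℝ³)] with ξ hξ
    refine (norm_fourier_le_weight_mul f hξ).trans ((le_abs_self _).trans_eq ?_)
    simp [hG, hw]
  calc ‖v x‖ₑ = ‖f x‖ₑ := by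
        rw [← ofReal_norm, ← ofReal_norm]
        exact congrArg ENNReal.ofReal (Complex.norm_real _).symm
    _ ≤ eLpNorm (𝓕 f : 𝓢(ℝ³, ℂ)) 1 volume := enorm_le_eLpNorm_one_fourier f x
    _ ≤ eLpNorm w 2 volume * ∑ i, eLpNorm (G i) 2 volume :=
        hfour.trans (mul_le_mul_right (eLpNorm_sum_le (fun i _ => hGm i) (by norm_num)) _)
    _ ≤ eLpNorm w 2 volume * ∑ _i : Fin 3, (eLpNorm (fun x => ‖iteratedFDeriv ℝ 1 v x‖) 2 volume
        + eLpNorm (fun x => ‖iteratedFDeriv ℝ 2 v x‖) 2 volume) := by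
        gcongr with i
        exact hGle i
    _ = _ := by
        rw [ENNReal.coe_mul, ENNReal.coe_toNNReal memLp_two_weight.eLpNorm_ne_top]
        simp only [Finset.sum_const, Finset.card_univ, Fintype.card_fin, nsmul_eq_mul, mul_assoc]
        rfl

theorem pd_iterate_iteratedFDeriv (i : Fin 3) (k n : ℕ) (m : Fin n → ℝ³) (hm : ∀ j, ‖m j‖ ≤ 1) :
    ∃ m' : Fin (n + k) → ℝ³, (∀ j, ‖m' j‖ ≤ 1) ∧ ∀ f : ℝ³ → ℝ, ContDiff ℝ (⊤ : ℕ∞) f →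
      (pd i)^[k] (fun x => iteratedFDeriv ℝ n f x m)
        = fun x => iteratedFDeriv ℝ (n + k) f x m' := by
  induction k with
  | zero => exact ⟨m, hm, fun f _ => rfl⟩
  | succ k ih =>
    obtain ⟨m', hm', h⟩ := ih
    refine ⟨Fin.cons (EuclideanSpace.single i (1 : ℝ)) m',
      fun j => Fin.cases (by simp) (fun j => by simpa using hm' j) j, fun f hf => ?_⟩
    rw [Function.iterate_succ_apply', h f hf]
    funext x
    have hd : DifferentiableAt ℝ (iteratedFDeriv ℝ (n + k) f) x :=
      hf.differentiable_iteratedFDeriv (by exact_mod_cast ENat.natCast_lt_top (n + k)) x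
    change fderiv ℝ (fun x => iteratedFDeriv ℝ (n + k) f x m') x _
      = iteratedFDeriv ℝ (n + k + 1) f x _
    rw [iteratedFDeriv_succ_apply_left, fderiv_continuousMultilinear_apply_const_apply hd]
    simp

theorem exists_Dmulti_eq_iteratedFDeriv (β : Fin 3 → ℕ) :
    ∃ m : Fin (∑ i, β i) → ℝ³, (∀ j, ‖m j‖ ≤ 1) ∧ ∀ f : ℝ³ → ℝ, ContDiff ℝ (⊤ : ℕ∞) f →
      Dmulti β f = fun x => iteratedFDeriv ℝ (∑ i, β i) f x m := by
  obtain ⟨m₂, h₂, e₂⟩ := pd_iterate_iteratedFDeriv 2 (β 2) 0 ![] (by simp)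
  obtain ⟨m₁, h₁, e₁⟩ := pd_iterate_iteratedFDeriv 1 (β 1) _ m₂ h₂
  obtain ⟨m₀, h₀, e₀⟩ := pd_iterate_iteratedFDeriv 0 (β 0) _ m₁ h₁
  have hsum : 0 + β 2 + β 1 + β 0 = ∑ i, β i := by rw [Fin.sum_univ_three]; ring
  rw [← hsum]
  refine ⟨m₀, h₀, fun f hf => ?_⟩
  rw [← e₀ f hf, ← e₁ f hf, ← e₂ f hf]
  simp [Dmulti]

/-- The zeroth-order Leibniz term drops out at `x` after replacing `u` by `u - u x`. -/
theorem norm_Dmulti_commutator_le (β : Fin 3 → ℕ) {u v : ℝ³ → ℝ}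
    (hu : ContDiff ℝ (⊤ : ℕ∞) u) (hv : ContDiff ℝ (⊤ : ℕ∞) v) (x : ℝ³) :
    ‖Dmulti β (fun y => u y * v y) x - u x * Dmulti β v x‖ ≤
      ∑ a ∈ Finset.Icc 1 (∑ i, β i), ((∑ i, β i).choose a : ℝ) *
        (‖iteratedFDeriv ℝ a u x‖ * ‖iteratedFDeriv ℝ ((∑ i, β i) - a) v x‖) := by
  obtain ⟨m, hm, hD⟩ := exists_Dmulti_eq_iteratedFDeriv β
  generalize ∑ i, β i = n at *
  have hu' : ContDiff ℝ (⊤ : ℕ∞) (fun y => u y - u x) := hu.sub contDiff_const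
  have hn : (n : WithTop ℕ∞) ≤ ((⊤ : ℕ∞) : WithTop ℕ∞) := by exact_mod_cast le_top
  have heq : Dmulti β (fun y => u y * v y) x - u x * Dmulti β v x
      = iteratedFDeriv ℝ n (fun y => (u y - u x) * v y) x m := by
    rw [hD _ (hu.mul hv), hD _ hv]
    have : (fun y => (u y - u x) * v y) = (fun y => u y * v y) - fun y => u x • v y := by
      funext y; simp [sub_mul]
    rw [this, iteratedFDeriv_sub ((hu.mul hv).of_le hn) ((hv.const_smul (u x)).of_le hn),
      Pi.sub_apply, iteratedFDeriv_const_smul_apply' (hv.of_le hn).contDiffAt]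
    simp
  rw [heq]
  refine (ContinuousMultilinearMap.le_opNorm _ _).trans
    ((mul_le_of_le_one_right (norm_nonneg _)
        (Finset.prod_le_one (fun _ _ => norm_nonneg _) fun j _ => hm j)).trans
    ((norm_iteratedFDeriv_mul_le hu' hv x hn).trans_eq ?_))
  rw [Finset.range_eq_Ico, Finset.sum_eq_sum_Ico_succ_bot (Nat.succ_pos n)]
  simp only [norm_iteratedFDeriv_zero, sub_self, norm_zero, mul_zero, zero_mul, zero_add]
  refine Finset.sum_congr rfl fun a ha => ?_
  obtain ⟨b, rfl⟩ : ∃ b, a = b + 1 := ⟨a - 1, by simp at ha; omega⟩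
  rw [mul_assoc, ← norm_iteratedFDeriv_fderiv, ← norm_iteratedFDeriv_fderiv (f := u)]
  rw [show fderiv ℝ (fun y => u y - u x) = fderiv ℝ u from funext fun y => fderiv_sub_const _]

theorem eLpNorm_two_iteratedFDeriv_le_RNorm {f : ℝ³ → ℝ} {j k : ℕ} (hj : 1 ≤ j) (hjk : j ≤ k) :
    eLpNorm (fun x => ‖iteratedFDeriv ℝ j f x‖) 2 volume ≤ RNorm k f :=
  (Finset.single_le_sum_of_canonicallyOrdered
    (f := fun j => eLpNorm (fun x => ‖iteratedFDeriv ℝ j f x‖) 2 volume)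
    (Finset.mem_Icc.2 ⟨hj, hjk⟩)).trans le_self_add

theorem eLpNorm_two_iteratedFDeriv_le_RNorm_fderiv_add {u : ℝ³ → ℝ} {a k : ℕ} (ha : 1 ≤ a)
    (hak : a ≤ k + 1) :
    eLpNorm (fun x => ‖iteratedFDeriv ℝ a u x‖) 2 volume
      ≤ RNorm k (fderiv ℝ u) + eLpNorm (fun x => ‖fderiv ℝ u x‖) 2 volume := by
  obtain ⟨b, rfl⟩ : ∃ b, a = b + 1 := ⟨a - 1, by omega⟩
  simp_rw [← norm_iteratedFDeriv_fderiv]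
  rcases Nat.eq_zero_or_pos b with rfl | hb
  · simp_rw [norm_iteratedFDeriv_zero]
    exact le_add_self
  · exact ((Finset.single_le_sum_of_canonicallyOrdered
      (f := fun j => eLpNorm (fun x => ‖iteratedFDeriv ℝ j (fderiv ℝ u) x‖) 2 volume)
      (Finset.mem_Icc.2 ⟨hb, by omega⟩)).trans le_self_add).trans le_self_add

/-- The products in the Leibniz expansion are estimated by Hölder with exponents `(3, 6)`, except for
the one carrying the top-order derivative of `u`, which is estimated with exponents `(2, ∞)`. -/
theorem exists_eLpNorm_two_iteratedFDeriv_mul_le (k : ℕ) (hk : 1 ≤ k) :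
    ∃ M : ℝ≥0, ∀ u v : ℝ³ → ℝ, ContDiff ℝ (⊤ : ℕ∞) u → HasCompactSupport u →
      ContDiff ℝ (⊤ : ℕ∞) v → HasCompactSupport v → ∀ a b : ℕ, 1 ≤ a → a + b ≤ k + 1 →
      eLpNorm (fun x => ‖iteratedFDeriv ℝ a u x‖ * ‖iteratedFDeriv ℝ b v x‖) 2 volume
        ≤ M * ((RNorm k (fderiv ℝ u) + eLpNorm (fun x => ‖fderiv ℝ u x‖) 2 volume)
          * RNorm (k + 1) v) := by
  choose K hK using exists_eLpNorm_six_iteratedFDeriv_le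
  obtain ⟨N, hN⟩ := exists_enorm_le_eLpNorm_two_iteratedFDeriv
  set L : ℝ≥0 := 1 + ∑ a ∈ Finset.range (k + 1), K a with hL
  have hKL : ∀ a ≤ k, (K a : ℝ≥0∞) ≤ L := fun a ha => by
    have : K a ≤ ∑ a ∈ Finset.range (k + 1), K a :=
      Finset.single_le_sum_of_canonicallyOrdered (Finset.mem_range.2 (by omega))
    exact_mod_cast this.trans le_add_self
  have h1L : (1 : ℝ≥0∞) ≤ L := by exact_mod_cast (le_self_add : (1 : ℝ≥0) ≤ L)
  refine ⟨L * L + N * 2, fun u v hu hcu hv hcv a b ha hab => ?_⟩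
  have hmeas : ∀ {f : ℝ³ → ℝ}, ContDiff ℝ (⊤ : ℕ∞) f → ∀ n : ℕ,
      AEStronglyMeasurable (fun x => ‖iteratedFDeriv ℝ n f x‖) volume := fun hf n =>
    (hf.continuous_iteratedFDeriv (by exact_mod_cast le_top)).norm.aestronglyMeasurable
  set A := RNorm k (fderiv ℝ u) + eLpNorm (fun x => ‖fderiv ℝ u x‖) 2 volume
  set R := RNorm (k + 1) v
  have hA : ∀ a, 1 ≤ a → a ≤ k + 1 →
      eLpNorm (fun x => ‖iteratedFDeriv ℝ a u x‖) 2 volume ≤ A := fun a h1 h2 =>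
    eLpNorm_two_iteratedFDeriv_le_RNorm_fderiv_add h1 h2
  have hR : ∀ b, 1 ≤ b → b ≤ k + 1 →
      eLpNorm (fun x => ‖iteratedFDeriv ℝ b v x‖) 2 volume ≤ R := fun b h1 h2 =>
    eLpNorm_two_iteratedFDeriv_le_RNorm h1 h2
  push_cast
  rw [add_mul]
  rcases Nat.lt_or_ge k a with hka | hka
  · obtain rfl : b = 0 := by omega
    refine le_trans ?_ le_add_self
    have hsup : eLpNorm (fun x => ‖iteratedFDeriv ℝ 0 v x‖) ∞ volume ≤ N * (R + R) := by
      rw [eLpNorm_exponent_top]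
      refine essSup_le_of_ae_le _ (.of_forall fun x => ?_)
      simp only [norm_iteratedFDeriv_zero, enorm_norm]
      exact (hN v hv hcv x).trans
        (mul_le_mul_right (add_le_add (hR 1 le_rfl (by omega)) (hR 2 (by omega) (by omega))) _)
    calc _ ≤ A * (N * (R + R)) :=
          (eLpNorm_smul_le_eLpNorm_mul_eLpNorm_top 2 _ (hmeas hu a)).trans
            (mul_le_mul' (hA a ha (by omega)) hsup)
      _ = _ := by ring
  · refine le_trans ?_ le_self_add
    have hH : ENNReal.HolderTriple 3 6 2 := ⟨by
      rw [← ENNReal.toReal_eq_toReal_iff' (by simp) (by simp),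
        ENNReal.toReal_add (by simp) (by simp)]
      norm_num⟩
    have hu3 : eLpNorm (fun x => ‖iteratedFDeriv ℝ a u x‖) 3 volume ≤ L * A := by
      refine eLpNorm_three_le_of_two_of_six (hmeas hu a) ?_ ?_
      · exact (hA a ha (by omega)).trans (le_mul_of_one_le_left' h1L)
      · exact (hK a u hu hcu).trans (mul_le_mul' (hKL a hka) (hA _ (by omega) (by omega)))
    have hv6 : eLpNorm (fun x => ‖iteratedFDeriv ℝ b v x‖) 6 volume ≤ L * R :=
      (hK b v hv hcv).trans (mul_le_mul' (hKL b (by omega)) (hR _ (by omega) (by omega)))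
    calc _ ≤ (L * A) * (L * R) :=
          (eLpNorm_smul_le_mul_eLpNorm (p := 3) (q := 6) (r := 2) (hmeas hv b) (hmeas hu a)).trans
            (mul_le_mul' hu3 hv6)
      _ = _ := by ring

/-- For integer `s ≥ 3`, multi-indices `β` with `0 ≤ |β| ≤ s-1`, and `u, v ∈ C₀^∞(ℝ³)`:
`‖[D^β, u] v‖_{L²} ≲ (‖Du‖_{R^{s-2}} + ‖Du‖_{L²}) ‖v‖_{R^{s-1}}`,
where `[D^β,u]v = D^β(uv) - u D^β v` and the constant depends only on `s`. -/
theorem stmt_15 (s : ℕ) (hs : 3 ≤ s) :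
    ∃ C : ℝ≥0, 0 < C ∧ ∀ β : Fin 3 → ℕ, (∑ i, β i) ≤ s - 1 →
      ∀ u v : EuclideanSpace ℝ (Fin 3) → ℝ,
        ContDiff ℝ (⊤ : ℕ∞) u → HasCompactSupport u → ContDiff ℝ (⊤ : ℕ∞) v → HasCompactSupport v →
        eLpNorm (fun x => Dmulti β (fun y => u y * v y) x - u x * Dmulti β v x) 2 volume
          ≤ C * (RNorm (s - 2) (fderiv ℝ u)
              + eLpNorm (fun x => ‖fderiv ℝ u x‖) 2 volume) * RNorm (s - 1) v := by
  obtain ⟨k, rfl⟩ : ∃ k, s = k + 2 := ⟨s - 2, by omega⟩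
  obtain ⟨M, hM⟩ := exists_eLpNorm_two_iteratedFDeriv_mul_le k (by omega)
  refine ⟨2 ^ (k + 1) * M + 1, by positivity, fun β hβ u v hu hcu hv hcv => ?_⟩
  simp only [Nat.add_sub_cancel, show k + 2 - 1 = k + 1 from rfl] at hβ ⊢
  have hpt := norm_Dmulti_commutator_le β hu hv
  generalize ∑ i, β i = n at *
  have hmeas : ∀ {f : ℝ³ → ℝ}, ContDiff ℝ (⊤ : ℕ∞) f → ∀ n : ℕ,
      Continuous (fun x => ‖iteratedFDeriv ℝ n f x‖) := fun hf n =>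
    (hf.continuous_iteratedFDeriv (by exact_mod_cast le_top)).norm
  set P := (RNorm k (fderiv ℝ u) + eLpNorm (fun x => ‖fderiv ℝ u x‖) 2 volume)
    * RNorm (k + 1) v with hP
  set T : ℕ → ℝ³ → ℝ := fun a => (n.choose a : ℝ) •
    fun x => ‖iteratedFDeriv ℝ a u x‖ * ‖iteratedFDeriv ℝ (n - a) v x‖ with hT
  have hTle : ∀ a ∈ Finset.Icc 1 n, eLpNorm (T a) 2 volume ≤ n.choose a * (M * P) := by
    intro a ha
    rw [Finset.mem_Icc] at ha
    rw [hT, eLpNorm_const_smul]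
    refine mul_le_mul' (by simp) (hM u v hu hcu hv hcv a (n - a) ha.1 (by omega))
  calc _ ≤ eLpNorm (∑ a ∈ Finset.Icc 1 n, T a) 2 volume :=
        eLpNorm_mono fun x => (hpt x).trans ((le_abs_self _).trans_eq (by simp [hT]))
    _ ≤ ∑ a ∈ Finset.Icc 1 n, eLpNorm (T a) 2 volume :=
        eLpNorm_sum_le (fun a _ => (((hmeas hu a).mul (hmeas hv (n - a))).const_smul
          (n.choose a : ℝ)).aestronglyMeasurable) (by norm_num)
    _ ≤ ∑ a ∈ Finset.Icc 1 n, (n.choose a : ℝ≥0∞) * (M * P) := Finset.sum_le_sum hTle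
    _ ≤ 2 ^ (k + 1) * (M * P) := by
        rw [← Finset.sum_mul]
        gcongr
        have h : ∑ a ∈ Finset.Icc 1 n, n.choose a ≤ 2 ^ (k + 1) :=
          calc _ ≤ ∑ a ∈ Finset.range (n + 1), n.choose a :=
                Finset.sum_le_sum_of_subset fun a ha => by
                  simp only [Finset.mem_Icc, Finset.mem_range] at ha ⊢; omega
            _ = 2 ^ n := Nat.sum_range_choose n
            _ ≤ _ := Nat.pow_le_pow_right (by norm_num) hβ
        exact_mod_cast h
    _ ≤ _ := by
        push_cast
        rw [mul_assoc _ (RNorm k (fderiv ℝ u) + _), ← hP, add_mul, mul_assoc]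
        exact le_self_add
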